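/- arXiv:1207.5132 — 3 statements merged into one kernel-verified Lean document; each statement's English description precedes it below -/
import Mathlib

section
/- Every 1-tough (K1 ∪ P2)-free graph on n ≥ 3 vertices is hamiltonian. -/
/-- A graph `G` is `H`-free if it contains no induced subgraph isomorphic to `H`,
i.e. there is no graph embedding of `H` into `G`. -/
def InducedFree {W V : Type*} (H : SimpleGraph W) (G : SimpleGraph V) : Prop :=
  ¬ Nonempty (H ↪g G)

/-- `K1 ∪ P2`: a vertex `0` together with an edge `{1, 2}`, the vertex `0` being
nonadjacent to both endpoints of the edge. -/
def K1P2 : SimpleGraph (Fin 3) := SimpleGraph.fromEdgeSet {s(1, 2)}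

/-- The number of connected components of the graph obtained from `G` by deleting
the vertices of `S`. -/
noncomputable def numCompDel {V : Type} [Fintype V] (G : SimpleGraph V) (S : Finset V) : ℕ :=
  Nat.card (G.induce ((↑S : Set V)ᶜ)).ConnectedComponent

/-- A finite graph is 1-tough if for every vertex subset `S` whose deletion disconnects
the graph (i.e. leaves at least two connected components), `|S|` is at least the number
of connected components of `G − S`. -/
def OneTough {V : Type} [Fintype V] (G : SimpleGraph V) : Prop :=
  ∀ S : Finset V, 2 ≤ numCompDel G S → numCompDel G S ≤ S.card

open SimpleGraph Finset in
/-- In a monotone colouring of `Fin n` whose colour classes have size at most `n / 2`, and whose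
class `0` has size exactly `n / 2` as soon as some class does, two indices of the same colour are
close to each other, and only a terminal segment of `Fin n` can attain the extremal distance. -/
theorem Fin.two_mul_sub_le_of_monotone {n : ℕ} {c : Fin n → ℕ} (hc : Monotone c)
    (hsize : ∀ k, 2 * #{i | c i = k} ≤ n)
    (hzero : ∀ k, 2 * #{i | c i = k} = n → 2 * #{i | c i = 0} = n)
    {i j : Fin n} (hij : i < j) (h : c i = c j) :
    2 * (j.val - i.val + 1) ≤ n ∧
      (2 * (j.val - i.val + 1) = n → i.val = 0 ∨ j.val = n - 1) := by
  have hsub : Finset.Icc i j ⊆ ({x | c x = c i} : Finset (Fin n)) := by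
    intro x hx
    rw [Finset.mem_Icc] at hx
    simpa using le_antisymm (h ▸ hc hx.2) (hc hx.1)
  have hcard := card_le_card hsub
  rw [Fin.card_Icc] at hcard
  have hi := hsize (c i)
  have hlt : i.val < j.val := hij
  refine ⟨by omega, fun heq => ?_⟩
  have h0 := hzero (c i) (by omega)
  by_cases hci : c i = 0
  · left
    have hn : 0 < n := i.pos
    have hle : c ⟨0, hn⟩ ≤ c i := hc (Fin.mk_le_of_le_val (Nat.zero_le _))
    have hmem : (⟨0, hn⟩ : Fin n) ∈ ({x | c x = c i} : Finset (Fin n)) := by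
      simp only [mem_filter, mem_univ, true_and]
      omega
    rw [← eq_of_subset_of_card_le hsub (by rw [Fin.card_Icc]; omega), Finset.mem_Icc] at hmem
    exact Nat.le_zero.mp hmem.1
  · right
    have hlow : ({x | c x = 0} : Finset (Fin n)) ⊆ Finset.Iio i := by
      intro x hx
      simp only [mem_filter, mem_univ, true_and] at hx
      rw [Finset.mem_Iio]
      by_contra hxi
      have := hc (not_lt.mp hxi)
      omega
    have := card_le_card hlow
    rw [Fin.card_Iio] at this
    omega

open SimpleGraph Finset in
/-- Interleaving the two halves of a monotone colouring of `Fin n` without too large colour classes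
gives a cyclic arrangement in which consecutive elements have different colours. -/
theorem Fin.exists_injective_forall_cycleGraph_adj_ne {n : ℕ} (hn : 2 ≤ n) {c : Fin n → ℕ}
    (hc : Monotone c) (hsize : ∀ k, 2 * #{i | c i = k} ≤ n)
    (hzero : ∀ k, 2 * #{i | c i = k} = n → 2 * #{i | c i = 0} = n) :
    ∃ e : Fin n → Fin n, Function.Injective e ∧
      ∀ i j, (cycleGraph n).Adj i j → c (e i) ≠ c (e j) := by
  let e : Fin n → Fin n := fun p =>
    ⟨if p.val % 2 = 0 then p.val / 2 else p.val / 2 + (n + 1) / 2, by split_ifs <;> omega⟩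
  have he (p : Fin n) : (e p).val =
    if p.val % 2 = 0 then p.val / 2 else p.val / 2 + (n + 1) / 2 := rfl
  have key (i j : Fin n) (hij : i.val + 1 = j.val ∨ i.val = n - 1 ∧ j.val = 0) :
      c (e i) ≠ c (e j) := by
    intro h
    have hi := he i
    have hj := he j
    rcases lt_trichotomy (e i) (e j) with hlt | heq | hlt
    · have := Fin.two_mul_sub_le_of_monotone hc hsize hzero hlt h
      rw [Fin.lt_def] at hlt
      split_ifs at hi hj <;> omega
    · rw [Fin.ext_iff] at heq
      split_ifs at hi hj <;> omega
    · have := Fin.two_mul_sub_le_of_monotone hc hsize hzero hlt h.symm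
      rw [Fin.lt_def] at hlt
      split_ifs at hi hj <;> omega
  have hsub (i j : Fin n) (h : (i - j).val = 1) :
      j.val + 1 = i.val ∨ j.val = n - 1 ∧ i.val = 0 := by
    rcases le_or_gt j i with hle | hlt
    · rw [Fin.coe_sub_iff_le.mpr hle] at h
      omega
    · rw [Fin.coe_sub_iff_lt.mpr hlt] at h
      omega
  refine ⟨e, fun i j hij => ?_, fun i j hij => ?_⟩
  · have hi := he i
    have hj := he j
    rw [hij] at hi
    rw [Fin.ext_iff]
    split_ifs at hi hj <;> omega
  · rcases cycleGraph_adj'.mp hij with h | h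
    · exact (key j i (hsub i j h)).symm
    · exact key i j (hsub j i h)

open SimpleGraph Finset in
/-- A graph is hamiltonian if it has a colouring by natural numbers such that differently coloured
vertices are adjacent and such that no colour class contains more than half of the vertices. -/
theorem SimpleGraph.isHamiltonian_of_forall_ne_adj {V : Type*} [Fintype V] [DecidableEq V]
    {G : SimpleGraph V} (hn : 3 ≤ Fintype.card V) {c : V → ℕ}
    (hadj : ∀ u v, c u ≠ c v → G.Adj u v)
    (hsize : ∀ k, 2 * #{v | c v = k} ≤ Fintype.card V)
    (hzero : ∀ k, 2 * #{v | c v = k} = Fintype.card V → 2 * #{v | c v = 0} = Fintype.card V) :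
    G.IsHamiltonian := by
  let f := (Fintype.equivFin V).symm
  let g : Fin (Fintype.card V) ≃ V := (Tuple.sort (c ∘ f)).trans f
  have hg : Monotone (c ∘ g) := Tuple.monotone_sort (c ∘ f)
  have hcard (k : ℕ) : #{i | (c ∘ g) i = k} = #{v | c v = k} :=
    card_equiv g (by simp)
  obtain ⟨e, he, hne⟩ := Fin.exists_injective_forall_cycleGraph_adj_ne (by omega) hg
    (by simpa only [hcard] using hsize) (by simpa only [hcard] using hzero)
  have hcon : cycleGraph (Fintype.card V) ⊑ G :=
    ⟨⟨⟨g ∘ e, fun {i j} hij => hadj _ _ (hne i j hij)⟩, g.injective.comp he⟩⟩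
  obtain ⟨v, p, hp, hlen⟩ := (cycleGraph_isContained_iff (by omega)).mp hcon
  exact fun _ => ⟨v, p, Walk.isHamiltonianCycle_iff_isCycle_and_length_eq.mpr ⟨hp, hlen⟩⟩

/-- A graph with no induced `K1 ∪ P2` is complete multipartite. -/
theorem InducedFree.isCompleteMultipartite {V : Type*} {G : SimpleGraph V}
    (h : InducedFree K1P2 G) : G.IsCompleteMultipartite := by
  by_contra hG
  obtain ⟨v, w₁, w₂, hw⟩ := G.exists_isPathGraph3Compl_of_not_isCompleteMultipartite hG
  have h₁ := hw.not_adj_fst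
  have h₂ := hw.not_adj_snd
  have h₃ := hw.adj
  refine h ⟨⟨⟨![v, w₁, w₂], ?_⟩, ?_⟩⟩
  · intro i j hij
    have := hw.ne_fst
    have := hw.ne_snd
    have := h₃.ne
    fin_cases i <;> fin_cases j <;> simp_all
  · intro i j
    change G.Adj (![v, w₁, w₂] i) (![v, w₁, w₂] j) ↔ K1P2.Adj i j
    fin_cases i <;> fin_cases j <;> simp [K1P2, h₁, h₂, h₃, h₃.symm, G.adj_comm _ v]

open SimpleGraph Finset in
/-- In a 1-tough complete multipartite graph, no part contains more than half of the vertices. -/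
theorem OneTough.two_mul_card_not_adj_le {V : Type} [Fintype V] [DecidableEq V]
    {G : SimpleGraph V} [DecidableRel G.Adj] (h : OneTough G) (hG : G.IsCompleteMultipartite)
    (hn : 2 ≤ Fintype.card V) (v : V) : 2 * #{u | ¬ G.Adj v u} ≤ Fintype.card V := by
  have hbot : G.induce ((({u | G.Adj v u} : Finset V) : Set V)ᶜ) = ⊥ := by
    ext ⟨x, hx⟩ ⟨y, hy⟩
    simp only [coe_filter, mem_univ, true_and, Set.mem_compl_iff, Set.mem_ofPred_eq] at hx hy
    simpa using hG.trans x v y (by rwa [G.adj_comm]) hy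
  have hnum : numCompDel G {u | G.Adj v u} = #{u | ¬ G.Adj v u} := by
    rw [numCompDel, hbot]
    let mk := (⊥ : SimpleGraph ↥((({u | G.Adj v u} : Finset V) : Set V)ᶜ)).connectedComponentMk
    have hmk : Function.Bijective mk :=
      ⟨fun x y hxy => reachable_bot.mp (ConnectedComponent.exact hxy), Quot.mk_surjective⟩
    rw [← Nat.card_eq_of_bijective mk hmk, ← coe_compl, Nat.card_coe_set_eq, Set.ncard_coe_finset,
      compl_filter]
  have hsum := card_filter_add_card_filter_not (s := (univ : Finset V)) (fun u => G.Adj v u)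
  rw [card_univ] at hsum
  by_cases h2 : 2 ≤ #{u | ¬ G.Adj v u}
  · have := h _ (hnum ▸ h2)
    omega
  · omega

/-- Every 1-tough `(K1 ∪ P2)`-free graph on `n ≥ 3` vertices is hamiltonian. -/
theorem stmt_5 {V : Type} [Fintype V] [DecidableEq V] (G : SimpleGraph V)
    (hn : 3 ≤ Fintype.card V) (htough : OneTough G) (hfree : InducedFree K1P2 G) :
    G.IsHamiltonian := by
  classical
  have hG := hfree.isCompleteMultipartite
  have : Nonempty V := Fintype.card_pos_iff.mp (by omega)
  have hhalf (v : V) := htough.two_mul_card_not_adj_le hG (by omega) v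
  obtain ⟨a, ha⟩ := Finite.exists_max fun v => Finset.card {u | ¬ G.Adj v u}
  let s := hG.setoid
  let t : Quotient s → ℕ := fun q =>
    if q = ⟦a⟧ then 0 else (Fintype.equivFin (Quotient s) q).val + 1
  have ht : Function.Injective t := by
    intro p q hpq
    simp only [t] at hpq
    split_ifs at hpq with hp hq
    · rw [hp, hq]
    · exact (Fintype.equivFin _).injective (Fin.ext (by omega))
  let c : V → ℕ := fun v => t ⟦v⟧
  have hc (u v : V) : c v = c u ↔ ¬ G.Adj u v :=
    ht.eq_iff.trans (eq_comm.trans Quotient.eq)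
  have hfib (v : V) : ({u | c u = c v} : Finset V) = ({u | ¬ G.Adj v u} : Finset V) := by
    simp only [hc]
  have hfib0 : ({u | c u = 0} : Finset V) = ({u | ¬ G.Adj a u} : Finset V) := by
    rw [← hfib, show c a = 0 from if_pos rfl]
  have hclass (k : ℕ) : ({u | c u = k} : Finset V) = ∅ ∨ ∃ v, c v = k := by
    by_cases h : ∃ v, c v = k
    · exact Or.inr h
    · exact Or.inl (Finset.filter_eq_empty_iff.mpr fun u _ hu => h ⟨u, hu⟩)
  refine SimpleGraph.isHamiltonian_of_forall_ne_adj hn (c := c)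
    (fun u v huv => by simpa [hc, G.adj_comm] using huv) (fun k => ?_) (fun k hk => ?_)
  · rcases hclass k with h | ⟨v, rfl⟩
    · simp [h]
    · rw [hfib]
      exact hhalf v
  · rcases hclass k with h | ⟨v, rfl⟩
    · rw [h, Finset.card_empty] at hk
      omega
    · rw [hfib] at hk
      rw [hfib0]
      have := ha v
      have := hhalf a
      omega
end

section
/- Let H be the graph with vertex set {x1, x2, x3, x4, x5, x6, x7} and edge set consisting of the 6-cycle x1x2, x2x3, x3x4, x4x5, x5x6, x6x1 together with the edges x7x1, x7x4 and x2x6. Then H is (K2 ∪ P3)-free, (K1 ∪ K_{1,3})-free, and (K1 ∪ P5)-free. -/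
/-- `K2 ∪ P3`: an edge `{0, 1}` together with an induced path `2 - 3 - 4`, with no edges
between the two parts. -/
def K2P3 : SimpleGraph (Fin 5) := SimpleGraph.fromEdgeSet {s(0, 1), s(2, 3), s(3, 4)}

/-- `K1 ∪ K_{1,3}`: an isolated vertex `0` together with a claw with center `1` and
leaves `2`, `3`, `4`. -/
def K1K13 : SimpleGraph (Fin 5) := SimpleGraph.fromEdgeSet {s(1, 2), s(1, 3), s(1, 4)}

/-- `K1 ∪ P5`: an isolated vertex `0` together with an induced path `1 - 2 - 3 - 4 - 5`. -/
def K1P5 : SimpleGraph (Fin 6) :=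
  SimpleGraph.fromEdgeSet {s(1, 2), s(2, 3), s(3, 4), s(4, 5)}

/-- The graph `H` on the vertices `x1, ..., x7` (represented by `0, ..., 6 : Fin 7`)
consisting of the 6-cycle `x1 x2 x3 x4 x5 x6 x1` together with the extra edges
`x7x1`, `x7x4` and `x2x6`. -/
def Hgraph : SimpleGraph (Fin 7) :=
  SimpleGraph.fromEdgeSet
    {s(0, 1), s(1, 2), s(2, 3), s(3, 4), s(4, 5), s(5, 0), s(6, 0), s(6, 3), s(1, 5)}

instance : DecidableRel K2P3.Adj := by unfold K2P3; infer_instance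

instance : DecidableRel K1K13.Adj := by unfold K1K13; infer_instance

instance : DecidableRel K1P5.Adj := by unfold K1P5; infer_instance

instance : DecidableRel Hgraph.Adj := by unfold Hgraph; infer_instance

theorem Hgraph_adj_of_path_antiadj_edge : ∀ a b, Hgraph.Adj a b →
    ∀ d, ¬ Hgraph.Adj a d → ¬ Hgraph.Adj b d → ∀ c, Hgraph.Adj c d →
    ¬ Hgraph.Adj a c → ¬ Hgraph.Adj b c → ∀ e, Hgraph.Adj d e →
    ¬ Hgraph.Adj a e → ¬ Hgraph.Adj b e → c ≠ e → Hgraph.Adj c e := by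
  decide

set_option synthInstance.maxSize 1000 in
theorem Hgraph_dominating_of_claw : ∀ b c, Hgraph.Adj b c →
    ∀ d, Hgraph.Adj b d → c ≠ d → ¬ Hgraph.Adj c d →
    ∀ e, Hgraph.Adj b e → c ≠ e → d ≠ e → ¬ Hgraph.Adj c e → ¬ Hgraph.Adj d e →
    ∀ a, a ≠ b → ¬ Hgraph.Adj a b → a ≠ c → ¬ Hgraph.Adj a c → a ≠ d →
    ¬ Hgraph.Adj a d → a ≠ e → Hgraph.Adj a e := by
  decide

theorem Hgraph_two_le_card_neighbors : ∀ a,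
    2 ≤ (Finset.univ.filter fun v => Hgraph.Adj a v).card := by
  decide

/-- The graph `H` is `(K2 ∪ P3)`-free, `(K1 ∪ K_{1,3})`-free and `(K1 ∪ P5)`-free. -/
theorem stmt_9 :
    InducedFree K2P3 Hgraph ∧ InducedFree K1K13 Hgraph ∧ InducedFree K1P5 Hgraph := by
  refine ⟨?_, ?_, ?_⟩ <;> rintro ⟨f⟩
  · have adj {i j} (h : K2P3.Adj i j) : Hgraph.Adj (f i) (f j) := f.map_adj_iff.2 h
    have nadj {i j} (h : ¬ K2P3.Adj i j) : ¬ Hgraph.Adj (f i) (f j) := mt f.map_adj_iff.1 h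
    have ne {i j} (h : i ≠ j) : f i ≠ f j := f.injective.ne h
    exact nadj (i := 2) (j := 4) (by decide) <|
      Hgraph_adj_of_path_antiadj_edge (f 0) (f 1) (adj (by decide))
        (f 3) (nadj (by decide)) (nadj (by decide))
        (f 2) (adj (by decide)) (nadj (by decide)) (nadj (by decide))
        (f 4) (adj (by decide)) (nadj (by decide)) (nadj (by decide))
        (ne (by decide))
  · have adj {i j} (h : K1K13.Adj i j) : Hgraph.Adj (f i) (f j) := f.map_adj_iff.2 h
    have nadj {i j} (h : ¬ K1K13.Adj i j) : ¬ Hgraph.Adj (f i) (f j) := mt f.map_adj_iff.1 h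
    have ne {i j} (h : i ≠ j) : f i ≠ f j := f.injective.ne h
    exact nadj (i := 0) (j := 4) (by decide) <|
      Hgraph_dominating_of_claw (f 1) (f 2) (adj (by decide))
        (f 3) (adj (by decide)) (ne (by decide)) (nadj (by decide))
        (f 4) (adj (by decide)) (ne (by decide)) (ne (by decide)) (nadj (by decide))
        (nadj (by decide))
        (f 0) (ne (by decide)) (nadj (by decide)) (ne (by decide)) (nadj (by decide))
        (ne (by decide)) (nadj (by decide)) (ne (by decide))
  · have isolated : ∀ i, ¬ K1P5.Adj 0 i := by decide
    have disj : Disjoint (Finset.univ.filter fun v => Hgraph.Adj (f 0) v)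
        (Finset.univ.map f.toEmbedding) := by
      rw [Finset.disjoint_left]
      intro v hv hv'
      obtain ⟨i, -, rfl⟩ := Finset.mem_map.1 hv'
      exact isolated i (f.map_adj_iff.1 (Finset.mem_filter.1 hv).2)
    have card_le := Finset.card_le_univ (Finset.disjUnion _ _ disj)
    rw [Finset.card_disjUnion, Finset.card_map, Finset.card_univ, Fintype.card_fin,
      Fintype.card_fin] at card_le
    have := Hgraph_two_le_card_neighbors (f 0)
    omega
end

section
/- Let G be a connected (K1 ∪ P2)-free graph on n vertices, let C be a longest cycle of G of length t, and suppose some vertex of G lies outside C. Then t is even, and there is a labeling C = v1 v2 ... vt v1 such that every vertex v ∉ V(C) has neighborhood exactly {v1, v3, ..., v_{t−1}}, and the set (V(G) \ V(C)) ∪ {v2, v4, ..., vt} is an independent set of size n − t/2 > n/2. -/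
open SimpleGraph

/-- In a `(K1 ∪ P2)`-free graph, nonadjacency is transitive. -/
theorem InducedFree.adj_or_adj {V : Type*} {G : SimpleGraph V} (hfree : InducedFree K1P2 G)
    {a b : V} (hab : G.Adj a b) (x : V) : G.Adj x a ∨ G.Adj x b := by
  by_contra! h
  obtain ⟨ha, hb⟩ := h
  have hxa : x ≠ a := fun e => hb (e ▸ hab)
  have hxb : x ≠ b := fun e => ha (e ▸ hab.symm)
  refine hfree ⟨⟨⟨![x, a, b], ?_⟩, ?_⟩⟩
  · intro i j hij
    have := hab.ne
    fin_cases i <;> fin_cases j <;> simp_all [eq_comm]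
  · intro i j
    have ha' : ¬ G.Adj a x := fun h => ha h.symm
    have hb' : ¬ G.Adj b x := fun h => hb h.symm
    change G.Adj (![x, a, b] i) (![x, a, b] j) ↔ K1P2.Adj i j
    fin_cases i <;> fin_cases j <;> simp [K1P2, ha, hb, ha', hb', hab, hab.symm]

namespace SimpleGraph.Walk

variable {V : Type*} {G : SimpleGraph V}

/-- Deleting the `i`-th edge of a cycle leaves a path. -/
theorem IsCycle.exists_isPath_delete_edge {u : V} {p : G.Walk u u} (hp : p.IsCycle) {i : ℕ}
    (hi : i < p.length) :
    ∃ q : G.Walk (p.getVert (i + 1)) (p.getVert i),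
      q.IsPath ∧ q.support ⊆ p.support ∧ q.length + 1 = p.length := by
  refine ⟨(p.drop (i + 1)).append (p.take i), ?_, ?_, ?_⟩
  · have h := hp.support_nodup
    rw [← p.append_take_drop_eq i, tail_support_append] at h
    have hd : (p.drop i).support.tail = (p.drop (i + 1)).support := by
      simp [drop_support_eq_support_drop_min, List.tail_drop, hi.le, Nat.succ_le_of_lt hi]
    rw [hd] at h
    rw [isPath_def, support_append]
    exact (List.perm_append_comm.nodup_iff).1 h
  · intro w hw
    rw [mem_support_append_iff] at hw
    rcases hw with hw | hw
    · rw [drop_support_eq_support_drop_min] at hw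
      exact List.mem_of_mem_drop hw
    · rw [support_take] at hw
      exact List.mem_of_mem_take hw
  · simp only [length_append, drop_length, take_length]
    omega

/-- A vertex outside a longest cycle is not adjacent to both ends of an edge of the cycle. -/
theorem IsCycle.not_adj_succ_of_longest {u : V} {p : G.Walk u u} (hp : p.IsCycle)
    (hlongest : ∀ (w : V) (q : G.Walk w w), q.IsCycle → q.length ≤ p.length)
    {x : V} (hx : x ∉ p.support) {i : ℕ} (hi : i < p.length)
    (h : G.Adj x (p.getVert i)) : ¬ G.Adj x (p.getVert (i + 1)) := by
  intro h'
  obtain ⟨q, hq, hsub, hlen⟩ := hp.exists_isPath_delete_edge hi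
  have hxq : x ∉ q.support := fun hx' => hx (hsub hx')
  have hcyc : (cons h.symm (cons h' q)).IsCycle := by
    rw [cons_isCycle_iff, cons_isPath_iff]
    refine ⟨⟨hq, hxq⟩, ?_⟩
    rw [edges_cons, List.mem_cons, not_or]
    refine ⟨?_, fun he => hxq (q.snd_mem_support_of_mem_edges he)⟩
    have := (p.adj_getVert_succ hi).ne
    grind
  have := hlongest _ _ hcyc
  simp only [length_cons] at this
  omega

/-- Two adjacent vertices outside a longest cycle are not adjacent to the two respective ends of
an edge of the cycle. -/
theorem IsCycle.not_adj_of_adj_of_longest {u : V} {p : G.Walk u u} (hp : p.IsCycle)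
    (hlongest : ∀ (w : V) (q : G.Walk w w), q.IsCycle → q.length ≤ p.length)
    {x y : V} (hx : x ∉ p.support) (hy : y ∉ p.support) (hxy : G.Adj x y) {i : ℕ}
    (hi : i < p.length) (h : G.Adj x (p.getVert i)) : ¬ G.Adj y (p.getVert (i + 1)) := by
  intro h'
  obtain ⟨q, hq, hsub, hlen⟩ := hp.exists_isPath_delete_edge hi
  have hxq : x ∉ q.support := fun hx' => hx (hsub hx')
  have hyq : y ∉ q.support := fun hy' => hy (hsub hy')
  have hcyc : (cons h.symm (cons hxy (cons h' q))).IsCycle := by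
    rw [cons_isCycle_iff, cons_isPath_iff, cons_isPath_iff]
    refine ⟨⟨⟨hq, hyq⟩, ?_⟩, ?_⟩
    · simp [hxy.ne, hxq]
    · rw [edges_cons, edges_cons, List.mem_cons, List.mem_cons, not_or, not_or]
      refine ⟨?_, ?_, fun he => hxq (q.snd_mem_support_of_mem_edges he)⟩
      · have : p.getVert i ≠ y := fun e => hy (e ▸ p.getVert_mem_support i)
        have := hxy.ne
        grind
      · have : x ≠ p.getVert (i + 1) := fun e => hx (e ▸ p.getVert_mem_support _)
        have := hxy.ne
        grind
  have := hlongest _ _ hcyc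
  simp only [length_cons] at this
  omega

end SimpleGraph.Walk

open SimpleGraph.Walk in
/-- A longest cycle of a `(K1 ∪ P2)`-free graph, started at a neighbor of a vertex outside it,
alternates between neighbors and nonneighbors of any outside vertex. -/
theorem adj_getVert_iff_even {V : Type*} {G : SimpleGraph V} (hfree : InducedFree K1P2 G)
    {u : V} {p : G.Walk u u} (hcyc : p.IsCycle)
    (hlongest : ∀ (w : V) (q : G.Walk w w), q.IsCycle → q.length ≤ p.length)
    {x : V} (hx : x ∉ p.support) (hxu : G.Adj x u) {i : ℕ} (hi : i ≤ p.length) :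
    G.Adj x (p.getVert i) ↔ Even i := by
  induction i with
  | zero => simpa using hxu
  | succ i ih =>
    have h₁ := hfree.adj_or_adj (p.adj_getVert_succ hi) x
    have h₂ := hcyc.not_adj_succ_of_longest hlongest hx hi
    have := ih (by omega)
    rw [Nat.even_add_one]
    tauto

/-- The structure of a longest cycle `p` of a `(K1 ∪ P2)`-free graph whose starting vertex is
adjacent to a vertex outside `p`. -/
theorem longest_cycle_structure {V : Type*} [Fintype V] {G : SimpleGraph V}
    (hfree : InducedFree K1P2 G) {u : V} {p : G.Walk u u} (hcyc : p.IsCycle)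
    (hlongest : ∀ (w : V) (q : G.Walk w w), q.IsCycle → q.length ≤ p.length)
    {x : V} (hx : x ∉ p.support) (hxu : G.Adj x u) :
    Even p.length ∧
    ∃ v : ℕ → V,
      (∀ i < p.length, ∀ j < p.length, v i = v j → i = j) ∧
      {x : V | x ∈ p.support} = v '' {i : ℕ | i < p.length} ∧
      (∀ i < p.length, G.Adj (v i) (v ((i + 1) % p.length))) ∧
      (∀ x : V, x ∉ p.support →
        G.neighborSet x = {w : V | ∃ i < p.length, Even i ∧ w = v i}) ∧
      ∃ S : Set V,
        S = {x : V | x ∉ p.support} ∪ {w : V | ∃ i < p.length, Odd i ∧ w = v i} ∧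
        (∀ x ∈ S, ∀ y ∈ S, ¬ G.Adj x y) ∧
        S.ncard = Fintype.card V - p.length / 2 ∧
        Fintype.card V < 2 * S.ncard := by
  classical
  have hpos : 3 ≤ p.length := hcyc.three_le_length
  have heven : Even p.length := by
    rw [← adj_getVert_iff_even hfree hcyc hlongest hx hxu le_rfl, p.getVert_length]
    exact hxu
  have halt : ∀ y, y ∉ p.support → ¬ G.Adj x y := fun y hy hxy => by
    have h1 := adj_getVert_iff_even hfree hcyc hlongest hx hxu (i := 1) (by omega)
    have h2 := hfree.adj_or_adj hxy (p.getVert 1)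
    have h3 := hcyc.not_adj_of_adj_of_longest hlongest hx hy hxy (i := 0) (by omega)
      (by simpa using hxu)
    rcases h2 with h2 | h2
    · exact absurd (h1.1 h2.symm) (by decide)
    · exact h3 h2.symm
  have hsupp : ∀ w, w ∈ p.support ↔ ∃ i < p.length, w = p.getVert i := by
    intro w
    refine ⟨fun hw => ?_, fun ⟨i, _, hi⟩ => hi ▸ p.getVert_mem_support i⟩
    obtain ⟨n, hn, hle⟩ := Walk.mem_support_iff_exists_getVert.1 hw
    rcases hle.lt_or_eq with h | h
    · exact ⟨n, h, hn.symm⟩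
    · exact ⟨0, by omega, by rw [← hn, h, p.getVert_length, p.getVert_zero]⟩
  have hinj : ∀ i < p.length, ∀ j < p.length, p.getVert i = p.getVert j → i = j :=
    fun i hi j hj h => hcyc.getVert_injOn' (by simp; omega) (by simp; omega) h
  have hxN : ∀ w, G.Adj x w ↔ ∃ i < p.length, Even i ∧ w = p.getVert i := by
    intro w
    constructor
    · intro hw
      obtain ⟨i, hi, rfl⟩ := (hsupp w).1 (by_contra fun h => halt w h hw)
      exact ⟨i, hi, (adj_getVert_iff_even hfree hcyc hlongest hx hxu hi.le).1 hw, rfl⟩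
    · rintro ⟨i, hi, he, rfl⟩
      exact (adj_getVert_iff_even hfree hcyc hlongest hx hxu hi.le).2 he
  have htrans : ∀ a b, ¬ G.Adj x a → ¬ G.Adj x b → ¬ G.Adj a b := fun a b ha hb hab =>
    (hfree.adj_or_adj hab x).elim ha hb
  have hS : {y : V | y ∉ p.support} ∪ {w : V | ∃ i < p.length, Odd i ∧ w = p.getVert i} =
      {w | G.Adj x w}ᶜ := by
    ext w
    simp only [Set.mem_union, Set.mem_ofPred_eq, Set.mem_compl_iff]
    constructor
    · rintro (hw | ⟨i, hi, ho, rfl⟩)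
      · exact halt w hw
      · rw [adj_getVert_iff_even hfree hcyc hlongest hx hxu hi.le]
        exact Nat.not_even_iff_odd.2 ho
    · intro hw
      by_contra! h
      obtain ⟨i, hi, rfl⟩ := (hsupp w).1 h.1
      rw [adj_getVert_iff_even hfree hcyc hlongest hx hxu hi.le, Nat.not_even_iff_odd] at hw
      exact h.2 i hi hw rfl
  have hNcard : {w | G.Adj x w}.ncard = p.length / 2 := by
    have : {w | G.Adj x w} =
        ((Finset.range (p.length / 2)).image fun k => p.getVert (2 * k) : Finset V) := by
      ext w
      rw [Set.mem_ofPred_eq, hxN]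
      simp only [Finset.coe_image, Finset.coe_range, Set.mem_image, Set.mem_Iio]
      constructor
      · rintro ⟨i, hi, ⟨k, rfl⟩, rfl⟩
        exact ⟨k, by have := heven.two_dvd; omega, by rw [two_mul]⟩
      · rintro ⟨k, hk, rfl⟩
        exact ⟨2 * k, by omega, even_two_mul k, rfl⟩
    rw [this, Set.ncard_coe_finset, Finset.card_image_of_injOn, Finset.card_range]
    intro a ha b hb hab
    simp only [Finset.coe_range, Set.mem_Iio] at ha hb
    have := hinj _ (by omega) _ (by omega) hab
    omega
  have hlt : p.length < Fintype.card V := by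
    have h := (List.nodup_cons.2 ⟨fun h => hx (List.mem_of_mem_tail h),
      hcyc.support_nodup⟩ : (x :: p.support.tail).Nodup).length_le_card
    simpa using h
  have hScard : ({w | G.Adj x w}ᶜ : Set V).ncard = Fintype.card V - p.length / 2 := by
    rw [Set.ncard_compl, hNcard, Nat.card_eq_fintype_card]
  refine ⟨heven, p.getVert, hinj, ?_, ?_, ?_, _, rfl, ?_, ?_, ?_⟩
  · ext w
    simp only [Set.mem_ofPred_eq, hsupp, Set.mem_image, eq_comm]
  · intro i hi
    have h := p.adj_getVert_succ hi
    rcases (Nat.succ_le_of_lt hi).lt_or_eq with h' | h'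
    · rwa [Nat.mod_eq_of_lt h']
    · have h'' : i + 1 = p.length := h'
      rw [h'', p.getVert_length] at h
      rwa [h'', Nat.mod_self, p.getVert_zero]
  · intro y hy
    ext w
    rw [mem_neighborSet, Set.mem_ofPred_eq, ← hxN]
    have hxy := halt y hy
    refine ⟨fun h => by_contra fun h' => htrans y w hxy h' h, fun h => ?_⟩
    exact ((hfree.adj_or_adj h y).resolve_left fun h' => hxy h'.symm)
  · rw [hS]
    exact fun a ha b hb => htrans a b ha hb
  · rw [hS, hScard]
  · rw [hS, hScard]
    omega

/-- Let `G` be a connected `(K1 ∪ P2)`-free graph on `n` vertices, let `C` be a longest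
cycle of `G` (given as a closed walk `p` that is a cycle of maximum length), of length
`t`, and suppose some vertex of `G` lies outside `C`. Then `t` is even and there is a
labeling `C = v1 v2 ... vt v1` (here `v (i : ℕ)` with `i < t` stands for `v_{i+1}`, so
the odd-labeled vertices `v1, v3, ..., v_{t-1}` are those `v i` with `i` even) such
that every vertex outside `C` has neighborhood exactly `{v1, v3, ..., v_{t-1}}`, and
`(V(G) \ V(C)) ∪ {v2, v4, ..., vt}` is an independent set of size `n − t/2 > n/2`. -/
theorem stmt_15 {V : Type} [Fintype V] (G : SimpleGraph V) (hconn : G.Connected)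
    (hfree : InducedFree K1P2 G)
    (u : V) (p : G.Walk u u) (hcyc : p.IsCycle)
    (hlongest : ∀ (w : V) (q : G.Walk w w), q.IsCycle → q.length ≤ p.length)
    (t : ℕ) (ht : p.length = t)
    (hout : ∃ x : V, x ∉ p.support) :
    Even t ∧
    ∃ v : ℕ → V,
      (∀ i < t, ∀ j < t, v i = v j → i = j) ∧
      {x : V | x ∈ p.support} = v '' {i : ℕ | i < t} ∧
      (∀ i < t, G.Adj (v i) (v ((i + 1) % t))) ∧
      (∀ x : V, x ∉ p.support →
        G.neighborSet x = {w : V | ∃ i < t, Even i ∧ w = v i}) ∧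
      ∃ S : Set V,
        S = {x : V | x ∉ p.support} ∪ {w : V | ∃ i < t, Odd i ∧ w = v i} ∧
        (∀ x ∈ S, ∀ y ∈ S, ¬ G.Adj x y) ∧
        S.ncard = Fintype.card V - t / 2 ∧
        Fintype.card V < 2 * S.ncard := by
  classical
  obtain ⟨x, hx⟩ := hout
  subst ht
  have h0 : 0 < p.length := by have := hcyc.three_le_length; omega
  have hex : ∃ w ∈ p.support, G.Adj x w := by
    rcases hfree.adj_or_adj (p.adj_getVert_succ h0) x with h | h
    exacts [⟨_, p.getVert_mem_support _, h⟩, ⟨_, p.getVert_mem_support _, h⟩]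
  obtain ⟨w, hw, hxw⟩ := hex
  have h := longest_cycle_structure hfree (p := p.rotate w hw)
    ((Walk.isCycle_rotate hw).2 hcyc) (by simpa using hlongest) (x := x)
    (by simpa using hx) hxw
  simpa only [Walk.mem_support_rotate_iff, Walk.length_rotate] using h
end
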